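/- Let A be the monomial algebra on 13 generators defined below and K the trivial A-module. Then K has projective dimension exactly 6 as an A-module. -/

import Mathlib

/-!
Let `K` be a field and `V` a 13-dimensional `K`-vector space with basis
`{m,n,p,q,r,s,t,u,v,w,x,y,z}`.  Let `A = T(V)/I` be the quotient of the free
(tensor) algebra on `V` by the two-sided ideal generated by the nine monomials
`mn²p, n²pqr, npqrs, pqrst, stu, tuvwx, uvwxy, vwxy², xy²z`, and regard `K` as
the trivial left `A`-module via the augmentation sending every generator to `0`.
-/

open CategoryTheory

/-- The thirteen generators `m,n,p,q,r,s,t,u,v,w,x,y,z` of the algebra `A`. -/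
inductive Gen : Type
  | m | n | p | q | r | s | t | u | v | w | x | y | z

variable (K : Type) [Field K]

open Gen

/-- The generator `i`, as an element of the tensor algebra `T(V)`. -/
noncomputable def g (i : Gen) : FreeAlgebra K Gen := FreeAlgebra.ι K i

/-- The relation identifying each of the nine defining monomials with `0`;
the quotient of `T(V)` by this relation is exactly `T(V)/I` where `I` is the
two-sided ideal generated by the nine monomials. -/
inductive MonRel : FreeAlgebra K Gen → FreeAlgebra K Gen → Prop
  | mnnp : MonRel (g K m * g K n * g K n * g K p) 0
  | nnpqr : MonRel (g K n * g K n * g K p * g K q * g K r) 0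
  | npqrs : MonRel (g K n * g K p * g K q * g K r * g K s) 0
  | pqrst : MonRel (g K p * g K q * g K r * g K s * g K t) 0
  | stu : MonRel (g K s * g K t * g K u) 0
  | tuvwx : MonRel (g K t * g K u * g K v * g K w * g K x) 0
  | uvwxy : MonRel (g K u * g K v * g K w * g K x * g K y) 0
  | vwxyy : MonRel (g K v * g K w * g K x * g K y * g K y) 0
  | xyyz : MonRel (g K x * g K y * g K y * g K z) 0

/-- The monomial algebra `A = T(V)/I`. -/
noncomputable abbrev A : Type := RingQuot (MonRel K)

/-- The augmentation `A →ₐ[K] K`, sending every generator to `0`. -/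
noncomputable def aug : A K →ₐ[K] K :=
  RingQuot.liftAlgHom K ⟨FreeAlgebra.lift K (fun _ => (0 : K)), by
    rintro x y h
    induction h <;> simp [g]⟩

/-- `K`, regarded as the trivial left `A`-module via the augmentation. -/
noncomputable def KMod : ModuleCat.{0} (A K) :=
  letI : Module (A K) K := Module.compHom K (aug K).toRingHom
  ModuleCat.of (A K) K



namespace CategoryTheory.ProjectiveResolution

open Limits

variable {C : Type*} [Category* C] [Abelian C]

theorem hasProjectiveDimensionLT {X : C} (P : ProjectiveResolution X) (n : ℕ)
    (hP : ∀ i, n ≤ i → IsZero (P.complex.X i)) : HasProjectiveDimensionLT X n := by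
  let := HasExt.standard C
  rw [hasProjectiveDimensionLT_iff]
  intro i hi Y e
  apply P.extEquivCohomologyClass.injective
  rw [P.extEquivCohomologyClass_zero]
  obtain ⟨c, hc⟩ := (P.extEquivCohomologyClass e).mk_surjective
  rw [← hc]
  suffices c = 0 by rw [this]; rfl
  ext p q hpq
  by_cases hq : q = 0
  · have hz : IsZero (P.cochainComplex.X p) :=
      (hP i hi).of_iso (P.cochainComplexXIso p i (by lia))
    exact hz.eq_of_src _ _
  · have hz : IsZero (((CochainComplex.singleFunctor C 0).obj Y).X q) :=
      HomologicalComplex.isZero_single_obj_X _ _ _ _ hq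
    exact hz.eq_of_tgt _ _

theorem exists_of_shortExact {S : ShortComplex C} (hS : S.ShortExact) [Projective S.X₂]
    (Q : ProjectiveResolution S.X₁) :
    ∃ P : ProjectiveResolution S.X₃, ∀ i, P.complex.X (i + 1) = Q.complex.X i := by
  obtain ⟨ε, hε, _, hex⟩ : ∃ (ε : Q.complex.X 0 ⟶ S.X₁) (hε : Q.complex.d 1 0 ≫ ε = 0),
      Epi ε ∧ (ShortComplex.mk _ _ hε).Exact :=
    ⟨Q.π.f 0, Q.complex_d_comp_π_f_zero, inferInstanceAs (Epi (Q.π.f 0)),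
      ShortComplex.exact_of_g_is_cokernel _ Q.isColimitCokernelCofork⟩
  have w : Q.complex.d 1 0 ≫ ε ≫ S.f = 0 := by
    rw [← Category.assoc, hε, zero_comp]
  let D := ChainComplex.augment Q.complex (ε ≫ S.f) w
  have hg : (ε ≫ S.f) ≫ S.g = 0 := by simp
  have h₀ : (ShortComplex.mk (ε ≫ S.f) S.g hg).Exact := by
    let α : ShortComplex.mk (ε ≫ S.f) S.g hg ⟶ S :=
      { τ₁ := ε
        τ₂ := 𝟙 _
        τ₃ := 𝟙 _ }
    have : Epi α.τ₁ := inferInstanceAs (Epi ε)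
    have : IsIso α.τ₂ := inferInstanceAs (IsIso (𝟙 _))
    have : Mono α.τ₃ := inferInstanceAs (Mono (𝟙 _))
    exact (ShortComplex.exact_iff_of_epi_of_isIso_of_mono α).2 hS.exact
  have h₁ : (ShortComplex.mk (Q.complex.d 1 0) (ε ≫ S.f) w).Exact := by
    let α : ShortComplex.mk (Q.complex.d 1 0) ε hε ⟶
        ShortComplex.mk (Q.complex.d 1 0) (ε ≫ S.f) w :=
      { τ₁ := 𝟙 _
        τ₂ := 𝟙 _
        τ₃ := S.f }
    have : Epi α.τ₁ := inferInstanceAs (Epi (𝟙 _))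
    have : IsIso α.τ₂ := inferInstanceAs (IsIso (𝟙 _))
    have : Mono α.τ₃ := hS.mono_f
    exact (ShortComplex.exact_iff_of_epi_of_isIso_of_mono α).1 hex
  let π : D ⟶ (ChainComplex.single₀ C).obj S.X₃ :=
    (ChainComplex.toSingle₀Equiv _ _).symm ⟨S.g, hg⟩
  have hπ₀ : π.f 0 = S.g := ChainComplex.toSingle₀Equiv_symm_apply_f_zero _ _
  have hπ : QuasiIso π := ⟨fun n => by
    match n with
    | 0 =>
      rw [ChainComplex.quasiIsoAt₀_iff, ShortComplex.quasiIso_iff_of_zeros' _ rfl rfl rfl]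
      have : Epi S.g := hS.epi_g
      refine (ShortComplex.exact_and_epi_g_iff_of_iso ?_).2 ⟨h₀, this⟩
      exact ShortComplex.isoMk (Iso.refl _) (Iso.refl _) (Iso.refl _)
        ((Category.id_comp _).trans (Category.comp_id (ε ≫ S.f)).symm)
        ((Category.id_comp _).trans (hπ₀.symm.trans (Category.comp_id (π.f 0)).symm))
    | n + 1 =>
      rw [quasiIsoAt_iff_exactAt' _ _ (ChainComplex.exactAt_succ_single_obj _ _),
        HomologicalComplex.exactAt_iff' _ (n + 2) (n + 1) n (by simp) (by simp)]
      match n with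
      | 0 => exact h₁
      | n + 1 => exact Q.exact_succ n⟩
  have hD : ∀ i, Projective (D.X i) := by
    rintro (_ | i)
    · exact inferInstanceAs (Projective S.X₂)
    · exact inferInstanceAs (Projective (Q.complex.X i))
  exact ⟨{ complex := D, π := π, projective := hD }, fun i => rfl⟩

theorem exists_isZero_of_hasProjectiveDimensionLT [EnoughProjectives C] (n : ℕ) (X : C)
    (hX : HasProjectiveDimensionLT X (n + 1)) :
    ∃ P : ProjectiveResolution X, ∀ i, n < i → IsZero (P.complex.X i) := by
  induction n generalizing X with
  | zero =>
    have : Projective X := (projective_iff_hasProjectiveDimensionLT_one).2 hX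
    exact ⟨self X, fun i hi => HomologicalComplex.isZero_single_obj_X _ _ _ _ hi.ne'⟩
  | succ n ih =>
    let S := ShortComplex.mk (kernel.ι (Projective.π X)) (Projective.π X) (kernel.condition _)
    have hS : S.ShortExact := { exact := ShortComplex.exact_kernel _ }
    have : Projective S.X₂ := inferInstanceAs (Projective (Projective.over X))
    obtain ⟨Q, hQ⟩ := ih S.X₁ ((hS.hasProjectiveDimensionLT_X₃_iff n this).1 hX)
    obtain ⟨P, hP⟩ := exists_of_shortExact hS Q
    refine ⟨P, ?_⟩
    rintro (_ | i) hi
    · lia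
    · rw [hP]
      exact hQ i (by lia)

end CategoryTheory.ProjectiveResolution

namespace MonomialAlgebra

instance : DecidableEq Gen := fun i j =>
  decidable_of_iff (i.ctorIdx = j.ctorIdx)
    ⟨by cases i <;> cases j <;> simp [Gen.ctorIdx], fun h => h ▸ rfl⟩

/-- The nine defining monomials. -/
def obstructions : List (List Gen) :=
  [[m, n, n, p], [n, n, p, q, r], [n, p, q, r, s], [p, q, r, s, t], [s, t, u],
    [t, u, v, w, x], [u, v, w, x, y], [v, w, x, y, y], [x, y, y, z]]

/-- A word is normal if it contains none of the defining monomials. -/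
def IsNormal (l : List Gen) : Prop := ∀ a ∈ obstructions, ¬ a <:+: l

instance (l : List Gen) : Decidable (IsNormal l) :=
  inferInstanceAs (Decidable (∀ a ∈ obstructions, ¬ a <:+: l))

theorem IsNormal.of_isInfix {l l' : List Gen} (h : IsNormal l) (h' : l' <:+: l) : IsNormal l' :=
  fun a ha hl => h a ha (hl.trans h')

theorem isNormal_nil : IsNormal [] := by decide

/-- The image of a word in the algebra. -/
noncomputable def word (l : List Gen) : A K :=
  (l.map fun i => RingQuot.mkAlgHom K (MonRel K) (g K i)).prod

@[simp]
theorem word_nil : word K [] = 1 := rfl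

theorem word_append (l l' : List Gen) : word K (l ++ l') = word K l * word K l' := by
  simp [word]

theorem word_eq_zero_of_mem {l : List Gen} (hl : l ∈ obstructions) : word K l = 0 := by
  simp only [obstructions, List.mem_cons, List.not_mem_nil, or_false] at hl
  rcases hl with rfl | rfl | rfl | rfl | rfl | rfl | rfl | rfl | rfl
  · simpa [word, mul_assoc] using RingQuot.mkAlgHom_rel K (MonRel.mnnp (K := K))
  · simpa [word, mul_assoc] using RingQuot.mkAlgHom_rel K (MonRel.nnpqr (K := K))
  · simpa [word, mul_assoc] using RingQuot.mkAlgHom_rel K (MonRel.npqrs (K := K))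
  · simpa [word, mul_assoc] using RingQuot.mkAlgHom_rel K (MonRel.pqrst (K := K))
  · simpa [word, mul_assoc] using RingQuot.mkAlgHom_rel K (MonRel.stu (K := K))
  · simpa [word, mul_assoc] using RingQuot.mkAlgHom_rel K (MonRel.tuvwx (K := K))
  · simpa [word, mul_assoc] using RingQuot.mkAlgHom_rel K (MonRel.uvwxy (K := K))
  · simpa [word, mul_assoc] using RingQuot.mkAlgHom_rel K (MonRel.vwxyy (K := K))
  · simpa [word, mul_assoc] using RingQuot.mkAlgHom_rel K (MonRel.xyyz (K := K))

theorem word_eq_zero {l : List Gen} (hl : ¬ IsNormal l) : word K l = 0 := by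
  simp only [IsNormal, not_forall, not_not] at hl
  obtain ⟨a, ha, l₁, l₂, rfl⟩ := hl
  simp [word_append, word_eq_zero_of_mem K ha]

/-- Left multiplication by a letter, on the vector space with basis all words, where the words
that are not normal are discarded. -/
noncomputable def letterOp (i : Gen) : Module.End K (List Gen →₀ K) :=
  Finsupp.linearCombination K fun l =>
    if IsNormal (i :: l) then Finsupp.single (i :: l) 1 else 0

theorem letterOp_single (i : Gen) (l : List Gen) :
    letterOp K i (Finsupp.single l 1) =
      if IsNormal (i :: l) then Finsupp.single (i :: l) 1 else 0 := by
  simp [letterOp]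

theorem prod_letterOp_single (a l : List Gen) (h : a ≠ [] ∨ IsNormal l) :
    (a.map (letterOp K)).prod (Finsupp.single l 1) =
      if IsNormal (a ++ l) then Finsupp.single (a ++ l) 1 else 0 := by
  induction a with
  | nil => simp_all
  | cons i a ih =>
    rw [List.map_cons, List.prod_cons, Module.End.mul_apply]
    rcases eq_or_ne a [] with rfl | ha
    · simp [letterOp_single]
    · rw [ih (.inl ha)]
      by_cases h₁ : IsNormal (a ++ l)
      · rw [if_pos h₁, letterOp_single, List.cons_append]
      · have h₂ : ¬ IsNormal (i :: (a ++ l)) :=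
          fun h₂ => h₁ (h₂.of_isInfix (List.suffix_cons i (a ++ l)).isInfix)
        simp [h₁, h₂]

theorem prod_letterOp_eq_zero {a : List Gen} (ha : a ∈ obstructions) :
    (a.map (letterOp K)).prod = 0 := by
  refine Finsupp.lhom_ext' fun l => LinearMap.ext_ring ?_
  have ha' : a ≠ [] := by rintro rfl; revert ha; decide
  have h : ¬ IsNormal (a ++ l) := fun h => h a ha (List.prefix_append a l).isInfix
  simpa [h] using prod_letterOp_single K a l (.inl ha')

/-- The representation of the algebra on the vector space with basis all words. -/
noncomputable def rep : A K →ₐ[K] Module.End K (List Gen →₀ K) :=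
  RingQuot.liftAlgHom K ⟨FreeAlgebra.lift K (letterOp K), by
    rintro _ _ (_ | _ | _ | _ | _ | _ | _ | _ | _)
    · simpa [g, mul_assoc] using prod_letterOp_eq_zero K (a := [m, n, n, p]) (by decide)
    · simpa [g, mul_assoc] using prod_letterOp_eq_zero K (a := [n, n, p, q, r]) (by decide)
    · simpa [g, mul_assoc] using prod_letterOp_eq_zero K (a := [n, p, q, r, s]) (by decide)
    · simpa [g, mul_assoc] using prod_letterOp_eq_zero K (a := [p, q, r, s, t]) (by decide)
    · simpa [g, mul_assoc] using prod_letterOp_eq_zero K (a := [s, t, u]) (by decide)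
    · simpa [g, mul_assoc] using prod_letterOp_eq_zero K (a := [t, u, v, w, x]) (by decide)
    · simpa [g, mul_assoc] using prod_letterOp_eq_zero K (a := [u, v, w, x, y]) (by decide)
    · simpa [g, mul_assoc] using prod_letterOp_eq_zero K (a := [v, w, x, y, y]) (by decide)
    · simpa [g, mul_assoc] using prod_letterOp_eq_zero K (a := [x, y, y, z]) (by decide)⟩

theorem rep_word (l : List Gen) : rep K (word K l) = (l.map (letterOp K)).prod := by
  simp only [word, map_list_prod, List.map_map]
  congr 2
  ext i : 1
  simp [rep, g]

/-- The coefficients of an element of the algebra on the basis of normal words. -/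
noncomputable def coeff : A K →ₗ[K] (List Gen →₀ K) :=
  LinearMap.applyₗ (Finsupp.single [] 1) ∘ₗ (rep K).toLinearMap

theorem coeff_word (l : List Gen) :
    coeff K (word K l) = if IsNormal l then Finsupp.single l 1 else 0 := by
  simpa [coeff, rep_word] using prod_letterOp_single K l [] (.inr isNormal_nil)

theorem coeff_word_apply (l l' : List Gen) :
    coeff K (word K l) l' = if IsNormal l ∧ l = l' then 1 else 0 := by
  by_cases h : IsNormal l <;> simp [coeff_word, h, Finsupp.single_apply]

theorem span_range_word : Submodule.span K (Set.range (word K)) = ⊤ := by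
  refine eq_top_iff.2 fun a _ => ?_
  obtain ⟨a, rfl⟩ := RingQuot.mkAlgHom_surjective K (MonRel K) a
  induction a using FreeAlgebra.induction with
  | grade0 c =>
    rw [AlgHom.commutes, Algebra.algebraMap_eq_smul_one]
    exact Submodule.smul_mem _ _ (Submodule.subset_span ⟨[], rfl⟩)
  | grade1 i => exact Submodule.subset_span ⟨[i], by simp [word, g]⟩
  | mul a b ha hb =>
    rw [map_mul]
    refine (Submodule.span_mul_span K _ _).trans_le (Submodule.span_mono ?_)
      (Submodule.mul_mem_mul (ha trivial) (hb trivial))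
    rintro _ ⟨_, ⟨l, rfl⟩, _, ⟨l', rfl⟩, rfl⟩
    exact ⟨l ++ l', word_append K l l'⟩
  | add a b ha hb =>
    rw [map_add]
    exact add_mem (ha trivial) (hb trivial)

variable {K} in
theorem linearMap_ext {M : Type*} [AddCommGroup M] [Module K M] {φ ψ : A K →ₗ[K] M}
    (h : ∀ l, φ (word K l) = ψ (word K l)) : φ = ψ :=
  LinearMap.ext_on_range (span_range_word K) h

theorem linearCombination_coeff (a : A K) :
    Finsupp.linearCombination K (word K) (coeff K a) = a := by
  refine LinearMap.congr_fun (f := Finsupp.linearCombination K (word K) ∘ₗ coeff K)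
    (g := LinearMap.id) (linearMap_ext fun l => ?_) a
  by_cases hl : IsNormal l <;> simp [coeff_word, hl, word_eq_zero]

theorem isNormal_of_coeff_ne_zero {a : A K} {l : List Gen} (h : coeff K a l ≠ 0) :
    IsNormal l := by
  contrapose! h
  refine LinearMap.congr_fun (f := Finsupp.lapply l ∘ₗ coeff K) (g := 0)
    (linearMap_ext fun l' => ?_) a
  simp only [LinearMap.comp_apply, Finsupp.lapply_apply, coeff_word_apply, LinearMap.zero_apply]
  exact if_neg (by rintro ⟨h', rfl⟩; exact h h')

theorem coeff_mul_word (a : A K) {l l' : List Gen} (h : IsNormal (l ++ l')) :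
    coeff K (a * word K l') (l ++ l') = coeff K a l := by
  refine LinearMap.congr_fun
    (f := Finsupp.lapply (l ++ l') ∘ₗ coeff K ∘ₗ LinearMap.mulRight K (word K l'))
    (g := Finsupp.lapply l ∘ₗ coeff K) (linearMap_ext fun b => ?_) a
  have hl : IsNormal l := h.of_isInfix (List.prefix_append _ _).isInfix
  simp only [LinearMap.comp_apply, Finsupp.lapply_apply, LinearMap.mulRight_apply, ← word_append,
    coeff_word_apply, List.append_left_inj]
  refine if_congr ⟨?_, ?_⟩ rfl rfl <;> rintro ⟨_, rfl⟩ <;> exact ⟨‹_›, rfl⟩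

theorem coeff_word_mul (a : A K) {l : List Gen} (h : IsNormal l) :
    coeff K (word K l * a) l = coeff K a [] := by
  refine LinearMap.congr_fun
    (f := Finsupp.lapply l ∘ₗ coeff K ∘ₗ LinearMap.mulLeft K (word K l))
    (g := Finsupp.lapply [] ∘ₗ coeff K) (linearMap_ext fun b => ?_) a
  simp only [LinearMap.comp_apply, Finsupp.lapply_apply, LinearMap.mulLeft_apply, ← word_append,
    coeff_word_apply, List.append_right_eq_self]
  refine if_congr ⟨?_, ?_⟩ rfl rfl <;> rintro ⟨_, rfl⟩
  · exact ⟨isNormal_nil, rfl⟩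
  · exact ⟨by simpa using h, rfl⟩

theorem suffix_of_coeff_mul_word_ne_zero {a : A K} {b l : List Gen}
    (h : coeff K (a * word K b) l ≠ 0) : b <:+ l := by
  contrapose! h
  refine LinearMap.congr_fun
    (f := Finsupp.lapply l ∘ₗ coeff K ∘ₗ LinearMap.mulRight K (word K b))
    (g := 0) (linearMap_ext fun c => ?_) a
  simp only [LinearMap.comp_apply, Finsupp.lapply_apply, LinearMap.mulRight_apply, ← word_append,
    coeff_word_apply, LinearMap.zero_apply]
  exact if_neg fun h' => h ⟨c, h'.2⟩

theorem aug_eq_coeff_nil (a : A K) : aug K a = coeff K a [] := by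
  refine LinearMap.congr_fun (f := (aug K).toLinearMap)
    (g := Finsupp.lapply [] ∘ₗ coeff K) (linearMap_ext fun l => ?_) a
  simp only [AlgHom.toLinearMap_apply, LinearMap.comp_apply, Finsupp.lapply_apply,
    coeff_word_apply]
  cases l <;> simp [isNormal_nil, word, aug, g]

/-- The left ideal generated by a list of words. -/
noncomputable def leftIdeal (S : List (List Gen)) : Submodule (A K) (A K) :=
  Submodule.span (A K) (word K '' {l | l ∈ S})

theorem leftIdeal_nil : leftIdeal K [] = ⊥ := by simp [leftIdeal]

theorem leftIdeal_cons (l : List Gen) (S : List (List Gen)) :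
    leftIdeal K (l :: S) = leftIdeal K [l] ⊔ leftIdeal K S := by
  have : {a | a ∈ l :: S} = {a | a ∈ [l]} ∪ {a | a ∈ S} := by ext; simp
  rw [leftIdeal, this, Set.image_union, Submodule.span_union, leftIdeal, leftIdeal]

theorem mem_leftIdeal_singleton {l : List Gen} {a : A K} :
    a ∈ leftIdeal K [l] ↔ ∃ b, b * word K l = a := by
  simp [leftIdeal, Submodule.mem_span_singleton]

theorem mem_leftIdeal_iff {S : List (List Gen)} {a : A K} :
    a ∈ leftIdeal K S ↔ ∀ l, coeff K a l ≠ 0 → ∃ b ∈ S, b <:+ l := by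
  constructor
  · induction S generalizing a with
    | nil => simp +contextual [leftIdeal_nil]
    | cons b S ih =>
      rw [leftIdeal_cons, Submodule.mem_sup]
      rintro ⟨a₁, h₁, a₂, h₂, rfl⟩ l hl
      obtain ⟨c, rfl⟩ := (mem_leftIdeal_singleton K).1 h₁
      by_cases hc : coeff K (c * word K b) l = 0
      · obtain ⟨b', hb', h'⟩ := ih h₂ l (by simpa [hc] using hl)
        exact ⟨b', List.mem_cons_of_mem _ hb', h'⟩
      · exact ⟨b, List.mem_cons_self, suffix_of_coeff_mul_word_ne_zero K hc⟩
  · intro h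
    rw [← linearCombination_coeff K a, Finsupp.linearCombination_apply]
    refine Submodule.sum_mem _ fun l hl => Submodule.smul_of_tower_mem _ _ ?_
    obtain ⟨b, hb, c, rfl⟩ := h l (Finsupp.mem_support_iff.1 hl)
    rw [word_append]
    exact Submodule.smul_mem _ _ (Submodule.subset_span ⟨b, hb, rfl⟩)

/-- Neither of two words is a suffix of the other one. -/
def Incomparable (l l' : List Gen) : Prop := ¬ l <:+ l' ∧ ¬ l' <:+ l

instance (l l' : List Gen) : Decidable (Incomparable l l') :=
  inferInstanceAs (Decidable (_ ∧ _))

theorem disjoint_leftIdeal {l : List Gen} {S : List (List Gen)}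
    (h : ∀ l' ∈ S, Incomparable l l') : Disjoint (leftIdeal K [l]) (leftIdeal K S) := by
  rw [Submodule.disjoint_def]
  intro a h₁ h₂
  suffices coeff K a = 0 by rw [← linearCombination_coeff K a, this, map_zero]
  ext b
  by_contra hb
  obtain ⟨l₁, hl₁, hb₁⟩ := (mem_leftIdeal_iff K).1 h₁ b hb
  obtain ⟨l₂, hl₂, hb₂⟩ := (mem_leftIdeal_iff K).1 h₂ b hb
  obtain rfl := List.mem_singleton.1 hl₁
  exact (List.suffix_or_suffix_of_suffix hb₁ hb₂).elim (h l₂ hl₂).1 (h l₂ hl₂).2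

/-- The words, possibly with redundancies, whose product with `l` starts with a defining
monomial that ends inside `l`. -/
def overlaps (l : List Gen) : List (List Gen) :=
  obstructions.flatMap fun a =>
    ((List.range a.length).filter fun k => 0 < k ∧ a.drop k <+: l).map fun k => a.take k

/-- The minimal generators of the left annihilator of the word `l`. -/
def annGens (l : List Gen) : List (List Gen) :=
  ((overlaps l).filter fun b => ∀ c ∈ overlaps l, c <:+ b → c = b).dedup

theorem mem_overlaps {l b : List Gen} :
    b ∈ overlaps l ↔ ∃ a ∈ obstructions, ∃ k, 0 < k ∧ k < a.length ∧ a.drop k <+: l ∧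
      a.take k = b := by
  simp [overlaps]
  grind

theorem mem_annGens {l b : List Gen} :
    b ∈ annGens l ↔ b ∈ overlaps l ∧ ∀ c ∈ overlaps l, c <:+ b → c = b := by
  simp [annGens]

theorem isNormal_of_mem_annGens {l b : List Gen} (h : b ∈ annGens l) : IsNormal b := by
  obtain ⟨a, ha, k, -, hk, -, rfl⟩ := mem_overlaps.1 (mem_annGens.1 h).1
  have : ∀ a ∈ obstructions, ∀ k ∈ List.range a.length, IsNormal (a.take k) := by decide
  exact this a ha k (List.mem_range.2 hk)

theorem ne_nil_of_mem_annGens {l b : List Gen} (h : b ∈ annGens l) : b ≠ [] := by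
  obtain ⟨a, ha, k, hk₀, hk, -, rfl⟩ := mem_overlaps.1 (mem_annGens.1 h).1
  rw [ne_eq, List.take_eq_nil_iff]
  rintro (rfl | rfl)
  · exact hk₀.false
  · simp at hk

theorem not_isNormal_append {l b : List Gen} (h : b ∈ annGens l) : ¬ IsNormal (b ++ l) := by
  obtain ⟨a, ha, k, -, -, ⟨c, rfl⟩, rfl⟩ := mem_overlaps.1 (mem_annGens.1 h).1
  refine fun h => h a ha ⟨[], c, ?_⟩
  rw [List.nil_append, ← List.append_assoc, List.take_append_drop]

theorem exists_mem_annGens_suffix {l b : List Gen} (h : b ∈ overlaps l) :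
    ∃ c ∈ annGens l, c <:+ b := by
  induction hn : b.length using Nat.strong_induction_on generalizing b with
  | _ n ih =>
    by_cases hb : ∀ c ∈ overlaps l, c <:+ b → c = b
    · exact ⟨b, mem_annGens.2 ⟨h, hb⟩, List.suffix_rfl⟩
    · push Not at hb
      obtain ⟨c, hc, hcb, hne⟩ := hb
      have hlt : c.length < n :=
        hn ▸ lt_of_le_of_ne hcb.length_le fun h' => hne (hcb.eq_of_length h')
      obtain ⟨d, hd, hdc⟩ := ih _ hlt hc rfl
      exact ⟨d, hd, hdc.trans hcb⟩

theorem exists_annGens_suffix_of_not_isNormal {l b : List Gen} (hl : IsNormal l)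
    (hb : IsNormal b) (h : ¬ IsNormal (b ++ l)) : ∃ c ∈ annGens l, c <:+ b := by
  simp only [IsNormal, not_forall, not_not] at h
  obtain ⟨a, ha, l₁, l₂, h⟩ := h
  rw [List.append_assoc, List.append_eq_append_iff] at h
  rcases h with ⟨d, rfl, h⟩ | ⟨d, rfl, rfl⟩
  · rw [List.append_eq_append_iff] at h
    rcases h with ⟨d', rfl, rfl⟩ | ⟨d', rfl, rfl⟩
    · exact absurd (List.infix_append' _ _ _) (hb a ha)
    · rcases eq_or_ne d [] with rfl | hd
      · exact absurd (List.prefix_append _ _).isInfix (hl d' (by simpa using ha))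
      rcases eq_or_ne d' [] with rfl | hd'
      · exact absurd (List.suffix_append _ _).isInfix (hb d (by simpa using ha))
      have : d ∈ overlaps (d' ++ l₂) := by
        refine mem_overlaps.2 ⟨_, ha, d.length, List.length_pos_iff.2 hd, ?_, ?_, ?_⟩
        · simpa using List.length_pos_iff.2 hd'
        · simp
        · simp
      obtain ⟨c, hc, hcd⟩ := exists_mem_annGens_suffix this
      exact ⟨c, hc, hcd.trans (List.suffix_append _ _)⟩
  · exact absurd (List.infix_append' _ _ _) (hl a ha)

theorem pairwise_incomparable_annGens (l : List Gen) : (annGens l).Pairwise Incomparable := by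
  refine (List.nodup_dedup _).pairwise_of_forall_ne fun b hb c hc hne => ?_
  have hb := mem_annGens.1 hb
  have hc := mem_annGens.1 hc
  exact ⟨fun h => hne (hc.2 b hb.1 h), fun h => hne (hb.2 c hc.1 h).symm⟩

theorem mul_word_eq_zero_iff {l : List Gen} (hl : IsNormal l) (a : A K) :
    a * word K l = 0 ↔ a ∈ leftIdeal K (annGens l) := by
  constructor
  · refine fun h => (mem_leftIdeal_iff K).2 fun b hb => ?_
    refine exists_annGens_suffix_of_not_isNormal hl (isNormal_of_coeff_ne_zero K hb) fun hbl => hb ?_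
    rw [← coeff_mul_word K a hbl, h, map_zero, Finsupp.zero_apply]
  · suffices leftIdeal K (annGens l) ≤ LinearMap.ker (LinearMap.toSpanSingleton (A K) _ (word K l))
      from fun h => this h
    rw [leftIdeal, Submodule.span_le]
    rintro _ ⟨b, hb, rfl⟩
    simp [← word_append, word_eq_zero K (not_isNormal_append hb)]

/-- Right multiplication by a word, as a map from the algebra to the left ideal it generates. -/
noncomputable def mulWord (l : List Gen) : A K →ₗ[A K] leftIdeal K [l] :=
  (LinearMap.toSpanSingleton (A K) (A K) (word K l)).codRestrict _ fun a =>
    (mem_leftIdeal_singleton K).2 ⟨a, rfl⟩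

theorem coe_mulWord (l : List Gen) (a : A K) : (mulWord K l a : A K) = a * word K l := rfl

theorem mulWord_surjective (l : List Gen) : Function.Surjective (mulWord K l) := by
  rintro ⟨a, ha⟩
  obtain ⟨b, rfl⟩ := (mem_leftIdeal_singleton K).1 ha
  exact ⟨b, rfl⟩

theorem ker_mulWord {l : List Gen} (hl : IsNormal l) :
    LinearMap.ker (mulWord K l) = leftIdeal K (annGens l) := by
  ext a
  rw [LinearMap.mem_ker, ← mul_word_eq_zero_iff K hl, ← coe_mulWord, Submodule.coe_eq_zero]

theorem hasProjectiveDimensionLT_sup_iff {R : Type} [Ring R] {M : Type} [AddCommGroup M]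
    [Module R M] {P Q : Submodule R M} (h : Disjoint P Q) (n : ℕ) :
    HasProjectiveDimensionLT (ModuleCat.of R ↥(P ⊔ Q)) n ↔
      HasProjectiveDimensionLT (ModuleCat.of R P) n ∧
        HasProjectiveDimensionLT (ModuleCat.of R Q) n := by
  have hinj : Function.Injective (P.subtype.coprod Q.subtype) := by
    rw [← LinearMap.ker_eq_bot, LinearMap.ker_coprod_of_disjoint_range] <;> simp [h]
  let e : ModuleCat.of R P ⊞ ModuleCat.of R Q ≅ ModuleCat.of R ↥(P ⊔ Q) :=
    ModuleCat.biprodIsoProd _ _ ≪≫ (LinearEquiv.ofInjective _ hinj ≪≫ₗ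
      LinearEquiv.ofEq _ _ (by simp [LinearMap.range_coprod])).toModuleIso
  constructor
  · intro _
    have := hasProjectiveDimensionLT_of_iso e.symm n
    let r₁ : Retract (ModuleCat.of R P) (ModuleCat.of R P ⊞ ModuleCat.of R Q) :=
      ⟨Limits.biprod.inl, Limits.biprod.fst, by simp⟩
    let r₂ : Retract (ModuleCat.of R Q) (ModuleCat.of R P ⊞ ModuleCat.of R Q) :=
      ⟨Limits.biprod.inr, Limits.biprod.snd, by simp⟩
    exact ⟨r₁.hasProjectiveDimensionLT n, r₂.hasProjectiveDimensionLT n⟩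
  · rintro ⟨_, _⟩
    exact hasProjectiveDimensionLT_of_iso e n

theorem hasProjectiveDimensionLT_leftIdeal_iff {S : List (List Gen)}
    (hS : S.Pairwise Incomparable) (n : ℕ) :
    HasProjectiveDimensionLT (ModuleCat.of (A K) (leftIdeal K S)) n ↔
      ∀ l ∈ S, HasProjectiveDimensionLT (ModuleCat.of (A K) (leftIdeal K [l])) n := by
  induction S with
  | nil =>
    refine iff_of_true ?_ (by simp)
    rw [leftIdeal_nil]
    have := (ModuleCat.isZero_of_subsingleton
      (ModuleCat.of (A K) (⊥ : Submodule (A K) (A K)))).hasProjectiveDimensionLT_zero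
    exact hasProjectiveDimensionLT_of_ge _ 0 n n.zero_le
  | cons l S ih =>
    rw [List.pairwise_cons] at hS
    rw [leftIdeal_cons, hasProjectiveDimensionLT_sup_iff (disjoint_leftIdeal K hS.1), ih hS.2,
      List.forall_mem_cons]

theorem annGens_eq_nil_of_projective {l : List Gen} (hl : IsNormal l)
    (h : Module.Projective (A K) (leftIdeal K [l])) : annGens l = [] := by
  obtain ⟨σ, hσ⟩ := Module.projective_lifting_property (mulWord K l) LinearMap.id
    (mulWord_surjective K l)
  have hσ' : σ (mulWord K l 1) * word K l = word K l := by
    simpa [coe_mulWord] using congr_arg Subtype.val (LinearMap.congr_fun hσ (mulWord K l 1))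
  have hone : coeff K (σ (mulWord K l 1)) [] = 1 := by
    rw [← coeff_mul_word K _ (l' := l) (by simpa using hl), hσ', coeff_word_apply]
    simp [hl]
  refine List.eq_nil_iff_forall_not_mem.2 fun b hb => one_ne_zero (α := K) ?_
  rw [← hone, ← coeff_word_mul K _ (isNormal_of_mem_annGens hb), ← smul_eq_mul, ← map_smul,
    ← map_smul, smul_eq_mul, mul_one]
  have : mulWord K l (word K b) = 0 := by
    rw [← LinearMap.mem_ker, ker_mulWord K hl]
    exact Submodule.subset_span ⟨b, hb, rfl⟩
  rw [this, map_zero, map_zero, Finsupp.zero_apply]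

/-- Whether the left ideal generated by the word `l` has projective dimension less than `k`. -/
def pdLT : ℕ → List Gen → Bool
  | 0, _ => false
  | k + 1, l => (annGens l).all (pdLT k)

theorem hasProjectiveDimensionLT_iff_pdLT {l : List Gen} (hl : IsNormal l) (n : ℕ) :
    HasProjectiveDimensionLT (ModuleCat.of (A K) (leftIdeal K [l])) n ↔ pdLT n l = true := by
  induction n generalizing l with
  | zero =>
    rw [hasProjectiveDimensionLT_zero_iff_isZero, ModuleCat.isZero_iff_subsingleton]
    refine iff_of_false (fun h => one_ne_zero (α := K) ?_) (by simp [pdLT])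
    have h₀ : word K l = 0 := congr_arg Subtype.val
      (Subsingleton.elim (⟨word K l, (mem_leftIdeal_singleton K).2 ⟨1, one_mul _⟩⟩ :
        leftIdeal K [l]) 0)
    simpa [hl, h₀] using (coeff_word_apply K l l).symm
  | succ n ih =>
    have hS := LinearMap.shortExact_shortComplexKer (R := A K) (M := A K)
      (N := leftIdeal K [l]) (mulWord_surjective K l)
    have hX₂ : Projective (ModuleCat.of (A K) (A K)) := inferInstance
    have hker : HasProjectiveDimensionLT (ModuleCat.of (A K) (LinearMap.ker (mulWord K l))) n ↔
        pdLT (n + 1) l = true := by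
      rw [ker_mulWord K hl,
        hasProjectiveDimensionLT_leftIdeal_iff K (pairwise_incomparable_annGens l), pdLT,
        List.all_eq_true]
      exact forall₂_congr fun b hb => ih (isNormal_of_mem_annGens hb)
    refine ⟨fun h => ?_, fun h => hS.hasProjectiveDimensionLT_X₃ n (hker.2 h) inferInstance⟩
    cases n with
    | zero =>
      have := (IsProjective.iff_projective (R := A K) (leftIdeal K [l])).2
        (projective_iff_hasProjectiveDimensionLT_one.2 h)
      rw [pdLT, annGens_eq_nil_of_projective K hl this, List.all_nil]
    | succ n => exact hker.1 ((hS.hasProjectiveDimensionLT_X₃_iff n hX₂).1 h)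

/-- The words of length one. -/
def letters : List (List Gen) :=
  [[m], [n], [p], [q], [r], [s], [t], [u], [v], [w], [x], [y], [z]]

/-- The augmentation, as a map of modules over the algebra. -/
noncomputable def augLinearMap : A K →ₗ[A K] KMod K :=
  { toFun := aug K
    map_add' := map_add (aug K)
    map_smul' := map_mul (aug K) }

theorem augLinearMap_surjective : Function.Surjective (augLinearMap K) :=
  fun c => ⟨algebraMap K (A K) c, (aug K).commutes c⟩

theorem ker_augLinearMap : LinearMap.ker (augLinearMap K) = leftIdeal K letters := by
  ext a
  have : a ∈ LinearMap.ker (augLinearMap K) ↔ aug K a = 0 := Iff.rfl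
  rw [this, aug_eq_coeff_nil, mem_leftIdeal_iff]
  constructor
  · intro h l hl
    have hne : l ≠ [] := by rintro rfl; exact hl h
    refine ⟨[l.getLast hne], ?_, l.dropLast, List.dropLast_append_getLast hne⟩
    cases l.getLast hne <;> decide
  · intro h
    by_contra h₀
    obtain ⟨b, hb, hb'⟩ := h [] h₀
    rw [List.suffix_nil.1 hb'] at hb
    revert hb
    decide

theorem hasProjectiveDimensionLT_KMod_iff (k : ℕ) :
    HasProjectiveDimensionLT (KMod K) (k + 2) ↔ letters.all (pdLT (k + 1)) = true := by
  have hS := LinearMap.shortExact_shortComplexKer (augLinearMap_surjective K)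
  refine (hS.hasProjectiveDimensionLT_X₃_iff k
    (inferInstanceAs (Projective (ModuleCat.of (A K) (A K))))).trans ?_
  change HasProjectiveDimensionLT (ModuleCat.of (A K) (LinearMap.ker (augLinearMap K))) _ ↔ _
  rw [ker_augLinearMap, hasProjectiveDimensionLT_leftIdeal_iff K (by decide), List.all_eq_true]
  have : ∀ l ∈ letters, IsNormal l := by decide
  exact forall₂_congr fun l hl => hasProjectiveDimensionLT_iff_pdLT K (this l hl) _

end MonomialAlgebra

/-- `K` has projective dimension exactly `6` as an `A`-module:
there is a projective resolution of `K` vanishing in homological degrees `> 6`,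
but none vanishing in homological degrees `> 5`. -/
theorem statement_2 :
    (∃ P : CategoryTheory.ProjectiveResolution (KMod K),
      ∀ i : ℕ, 6 < i → CategoryTheory.Limits.IsZero (P.complex.X i)) ∧
    ¬ (∃ P : CategoryTheory.ProjectiveResolution (KMod K),
      ∀ i : ℕ, 5 < i → CategoryTheory.Limits.IsZero (P.complex.X i)) := by
  constructor
  · exact ProjectiveResolution.exists_isZero_of_hasProjectiveDimensionLT 6 _
      ((MonomialAlgebra.hasProjectiveDimensionLT_KMod_iff K 5).2 (by decide))
  · rintro ⟨P, hP⟩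
    have h := (MonomialAlgebra.hasProjectiveDimensionLT_KMod_iff K 4).1
      (P.hasProjectiveDimensionLT 6 hP)
    revert h
    decide
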